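/- Let ψ : [0,1]^d → ℝ^r be a bounded continuous function with first coordinate the constant 1 and linearly independent coordinates, and let β ∈ ℝ^r be such that some copula distribution with finite differential entropy satisfies E[ψ] = β; let H_M denote the (maximum-entropy) value sup h(P) over copula distributions P with E_P[ψ] = β. For each integer k ≥ 1, let φ^k(u) := (1, u_1, u_1², …, u_1^k, …, u_d, u_d², …, u_d^k, ψ(u)) and α^k := (1, 1/2, 1/3, …, 1/(1+k), …, 1/2, 1/3, …, 1/(1+k), β), and let H_AM(k) denote sup h(Q) over absolutely continuous probability measures Q on [0,1]^d with E_Q[φ^k] = α^k. Then H_AM(k) → H_M as k → ∞. -/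

import Mathlib

open MeasureTheory Real Set Filter

noncomputable section
open scoped Classical

/-- The unit cube `[0,1]^d`. -/
def Cube (d : ℕ) : Set (Fin d → ℝ) := Set.univ.pi fun _ => Set.Icc (0:ℝ) 1

/-- The uniform distribution on `[0,1]`. -/
def unif01 : Measure ℝ := volume.restrict (Set.Icc (0:ℝ) 1)

/-- A copula distribution on `[0,1]^d`: a probability measure supported on the cube,
absolutely continuous w.r.t. Lebesgue measure, with uniform one-dimensional marginals. -/
structure IsCopula {d : ℕ} (P : Measure (Fin d → ℝ)) : Prop where
  prob : IsProbabilityMeasure P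
  ac : P ≪ volume
  mass : P (Cube d) = 1
  marg : ∀ i : Fin d, P.map (fun u => u i) = unif01

/-- Lebesgue density of a measure. -/
def dens {α : Type*} [MeasureSpace α] (P : Measure α) : α → ℝ :=
  fun x => (P.rnDeriv volume x).toReal

/-- Differential entropy `-∫ p log p` (w.r.t. Lebesgue measure). -/
def diffEnt {α : Type*} [MeasureSpace α] (P : Measure α) : ℝ :=
  - ∫ x, dens P x * Real.log (dens P x)

/-- The differential entropy of `P` exists and is finite. -/
def FiniteEnt {α : Type*} [MeasureSpace α] (P : Measure α) : Prop :=
  Integrable (fun x => dens P x * Real.log (dens P x))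

open scoped ENNReal Topology

lemma sq_sqrt_sub_sqrt_le_mul_log_sub {a s : ℝ} (ha : 0 ≤ a) (hs : 0 < s) :
    (√a - √s) ^ 2 + (a - s) ≤ a * log a - a * log s := by
  rcases ha.eq_or_lt with rfl | ha
  · simp [hs.le]
  · have hsa := Real.sqrt_pos.2 ha
    have h := mul_le_mul_of_nonneg_left
      (Real.one_sub_inv_le_log_of_pos (div_pos hsa (Real.sqrt_pos.2 hs))) (mul_nonneg zero_le_two ha.le)
    rw [Real.log_div hsa.ne' (Real.sqrt_pos.2 hs).ne', Real.log_sqrt ha.le, Real.log_sqrt hs.le,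
      inv_div] at h
    have e : a * (√s / √a) = √a * √s := by
      field_simp
      rw [Real.sq_sqrt ha.le]
    nlinarith [Real.sq_sqrt ha.le, Real.sq_sqrt hs.le]

/-- A pointwise form of Pinsker's inequality for the Jensen gap of `x ↦ x * log x`. -/
lemma abs_sub_le_jensen_gap_mul_log {a b ε : ℝ} (ha : 0 ≤ a) (hb : 0 ≤ b) (hε : 0 < ε) :
    |a - b| ≤ 3 * ε * (a + b) +
      ε⁻¹ * (a * log a + b * log b - 2 * ((a + b) / 2 * log ((a + b) / 2))) := by
  rcases (add_nonneg ha hb).eq_or_lt with h | h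
  · have h1 : a = 0 := by linarith
    have h2 : b = 0 := by linarith
    simp [h1, h2]
  set s := (a + b) / 2 with hs
  have hs0 : 0 < s := by positivity
  have h1 := sq_sqrt_sub_sqrt_le_mul_log_sub ha hs0
  have h2 := sq_sqrt_sub_sqrt_le_mul_log_sub hb hs0
  have hJ : (√a - √s) ^ 2 ≤ a * log a + b * log b - 2 * (s * log s) := by
    have : 2 * (s * log s) = a * log s + b * log s := by rw [hs]; ring
    nlinarith [sq_nonneg (√b - √s)]
  have hab : |a - b| = 2 * (|√a - √s| * (√a + √s)) := by
    have : a - b = 2 * ((√a - √s) * (√a + √s)) := by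
      linarith [Real.sq_sqrt ha, Real.sq_sqrt hs0.le,
        show (√a - √s) * (√a + √s) = √a ^ 2 - √s ^ 2 by ring]
    rw [this, abs_mul, abs_mul, abs_two, abs_of_nonneg (by positivity : 0 ≤ √a + √s)]
  have hsum : (√a + √s) ^ 2 ≤ 3 * (a + b) := by
    nlinarith [sq_nonneg (√a - √s), Real.sq_sqrt ha, Real.sq_sqrt hs0.le]
  have hgm : 2 * (|√a - √s| * (√a + √s)) ≤ ε * (√a + √s) ^ 2 + ε⁻¹ * (√a - √s) ^ 2 := by
    rw [← sq_abs (√a - √s)]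
    have : ε * (√a + √s) ^ 2 + ε⁻¹ * |√a - √s| ^ 2 - 2 * (|√a - √s| * (√a + √s))
        = ε⁻¹ * (ε * (√a + √s) - |√a - √s|) ^ 2 := by
      field_simp
      ring
    have : 0 ≤ ε⁻¹ * (ε * (√a + √s) - |√a - √s|) ^ 2 := by positivity
    linarith
  rw [hab]
  have := mul_le_mul_of_nonneg_left hJ (inv_nonneg.2 hε.le)
  have := mul_le_mul_of_nonneg_left hsum hε.le
  linarith

section L1

variable {α : Type*} [MeasurableSpace α] {μ : Measure α}

/-- Completeness of `L¹`, phrased for sequences of integrable functions. -/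
lemma exists_integrable_tendsto_integral_abs_sub {F : ℕ → α → ℝ} (hF : ∀ n, Integrable (F n) μ)
    (hC : ∀ e > 0, ∃ N, ∀ n ≥ N, ∀ m ≥ n, ∫ x, |F n x - F m x| ∂μ < e) :
    ∃ f, Integrable f μ ∧ Tendsto (fun n => ∫ x, |F n x - f x| ∂μ) atTop (𝓝 0) ∧
      ∃ ns : ℕ → ℕ, StrictMono ns ∧ ∀ᵐ x ∂μ, Tendsto (fun i => F (ns i) x) atTop (𝓝 (f x)) := by
  have hdist : ∀ {f g : α → ℝ} (hf : Integrable f μ) (hg : Integrable g μ),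
      dist (hf.toL1 f) (hg.toL1 g) = ∫ x, |f x - g x| ∂μ := by
    intro f g hf hg
    rw [dist_eq_norm, ← Integrable.toL1_sub, L1.norm_of_fun_eq_integral_norm]
    rfl
  have hcau : CauchySeq fun n => (hF n).toL1 (F n) := by
    rw [Metric.cauchySeq_iff']
    intro e he
    obtain ⟨N, hN⟩ := hC e he
    refine ⟨N, fun n hn => ?_⟩
    rw [dist_comm, hdist]
    exact hN N le_rfl n hn
  obtain ⟨g, hg⟩ := cauchySeq_tendsto_of_complete hcau
  have hgi := L1.integrable_coeFn g
  refine ⟨g, hgi, ?_, ?_⟩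
  · have := tendsto_iff_dist_tendsto_zero.1 hg
    refine this.congr fun n => ?_
    rw [← hdist (hF n) hgi, Integrable.toL1_coeFn]
  · obtain ⟨ns, hns, h⟩ := (tendstoInMeasure_of_tendsto_Lp hg).exists_seq_tendsto_ae
    refine ⟨ns, hns, ?_⟩
    filter_upwards [h, ae_all_iff.2 fun n => (hF n).coeFn_toL1] with x hx hx'
    simpa only [hx'] using hx

lemma tendsto_integral_mul_of_tendsto_integral_abs_sub {F : ℕ → α → ℝ} {f g : α → ℝ} {M : ℝ}
    (hF : ∀ n, Integrable (F n) μ) (hf : Integrable f μ)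
    (hlim : Tendsto (fun n => ∫ x, |F n x - f x| ∂μ) atTop (𝓝 0))
    (hgm : AEStronglyMeasurable g μ) (hg : ∀ᵐ x ∂μ, |g x| ≤ M) :
    Tendsto (fun n => ∫ x, F n x * g x ∂μ) atTop (𝓝 (∫ x, f x * g x ∂μ)) := by
  rw [tendsto_iff_norm_sub_tendsto_zero]
  refine squeeze_zero (fun _ => norm_nonneg _) (fun n => ?_) (by simpa using hlim.mul_const M)
  rw [← integral_sub ((hF n).mul_bdd hgm hg) (hf.mul_bdd hgm hg), ← integral_mul_const]
  refine norm_integral_le_of_norm_le (((hF n).sub hf).abs.mul_const M) ?_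
  filter_upwards [hg] with x hx
  rw [← sub_mul, norm_mul]
  exact mul_le_mul_of_nonneg_left hx (abs_nonneg _)

/-- Fatou's lemma for real-valued functions. -/
lemma integrable_and_integral_le_of_tendsto_ae {F : ℕ → α → ℝ} {f : α → ℝ} {b : ℕ → ℝ} {c : ℝ}
    (hF : ∀ n, Integrable (F n) μ) (h0 : ∀ n, 0 ≤ᵐ[μ] F n) (hfm : AEStronglyMeasurable f μ)
    (hlim : ∀ᵐ x ∂μ, Tendsto (fun n => F n x) atTop (𝓝 (f x)))
    (hb : ∀ n, ∫ x, F n x ∂μ ≤ b n) (hc : Tendsto b atTop (𝓝 c)) :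
    Integrable f μ ∧ ∫ x, f x ∂μ ≤ c := by
  have hf0 : 0 ≤ᵐ[μ] f := by
    filter_upwards [hlim, ae_all_iff.2 h0] with x hx hx0
    exact ge_of_tendsto' hx hx0
  have hle : ∫⁻ x, ENNReal.ofReal (f x) ∂μ ≤ ENNReal.ofReal c :=
    calc ∫⁻ x, ENNReal.ofReal (f x) ∂μ
        = ∫⁻ x, liminf (fun n => ENNReal.ofReal (F n x)) atTop ∂μ := by
          refine lintegral_congr_ae ?_
          filter_upwards [hlim] with x hx
          exact ((ENNReal.continuous_ofReal.tendsto _).comp hx).liminf_eq.symm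
      _ ≤ liminf (fun n => ∫⁻ x, ENNReal.ofReal (F n x) ∂μ) atTop :=
          lintegral_liminf_le' fun n => (hF n).1.aemeasurable.ennreal_ofReal
      _ ≤ liminf (fun n => ENNReal.ofReal (b n)) atTop := by
          refine liminf_le_liminf (Eventually.of_forall fun n => ?_)
          rw [← ofReal_integral_eq_lintegral_ofReal (hF n) (h0 n)]
          exact ENNReal.ofReal_le_ofReal (hb n)
      _ = ENNReal.ofReal c := ((ENNReal.continuous_ofReal.tendsto _).comp hc).liminf_eq
  have hfi : Integrable f μ :=
    (lintegral_ofReal_ne_top_iff_integrable hfm hf0).1 (hle.trans_lt ENNReal.ofReal_lt_top).ne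
  have hc0 : 0 ≤ c := ge_of_tendsto' hc fun n => (integral_nonneg_of_ae (h0 n)).trans (hb n)
  rw [← ofReal_integral_eq_lintegral_ofReal hfi hf0] at hle
  exact ⟨hfi, (ENNReal.ofReal_le_ofReal_iff hc0).1 hle⟩

lemma integrable_klFun_iff [IsFiniteMeasure μ] {f : α → ℝ} (hf : Integrable f μ) :
    Integrable (fun x => InformationTheory.klFun (f x)) μ ↔
      Integrable (fun x => f x * log (f x)) μ := by
  refine ⟨fun h => ?_, fun h => (h.add (integrable_const 1)).sub hf⟩
  refine ((h.sub (integrable_const 1)).add hf).congr (Eventually.of_forall fun x => ?_)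
  simp only [InformationTheory.klFun_apply, Pi.add_apply, Pi.sub_apply]
  ring

lemma integral_klFun_comp [IsFiniteMeasure μ] {f : α → ℝ} (hf : Integrable f μ)
    (hf' : Integrable (fun x => f x * log (f x)) μ) :
    ∫ x, InformationTheory.klFun (f x) ∂μ =
      (∫ x, f x * log (f x) ∂μ) + μ.real univ - ∫ x, f x ∂μ := by
  have hi : Integrable (fun x => f x * log (f x) + 1) μ := hf'.add (integrable_const 1)
  simp only [InformationTheory.klFun_apply]
  rw [integral_sub hi hf, integral_add hf' (integrable_const 1)]
  simp

lemma integrable_klFun_midpoint [IsFiniteMeasure μ] {f g : α → ℝ} (hf : Integrable f μ)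
    (hg : Integrable g μ) (hf0 : 0 ≤ᵐ[μ] f) (hg0 : 0 ≤ᵐ[μ] g)
    (hf' : Integrable (fun x => InformationTheory.klFun (f x)) μ)
    (hg' : Integrable (fun x => InformationTheory.klFun (g x)) μ) :
    Integrable (fun x => InformationTheory.klFun ((f x + g x) / 2)) μ := by
  refine ((hf'.add hg').div_const 2).mono'
    (InformationTheory.continuous_klFun.comp_aestronglyMeasurable ((hf.add hg).div_const 2).1) ?_
  filter_upwards [hf0, hg0] with x hx hy
  have h0 : 0 ≤ (f x + g x) / 2 := div_nonneg (add_nonneg hx hy) zero_le_two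
  rw [Real.norm_of_nonneg (InformationTheory.klFun_nonneg h0)]
  have := InformationTheory.convexOn_klFun.2 (mem_Ici.2 hx) (mem_Ici.2 hy)
    (show (0 : ℝ) ≤ 1 / 2 by norm_num) (show (0 : ℝ) ≤ 1 / 2 by norm_num) (by norm_num)
  simp only [smul_eq_mul] at this
  rw [show (f x + g x) / 2 = 1 / 2 * f x + 1 / 2 * g x by ring]
  simp only [Pi.add_apply]
  linarith

/-- A near-maximizing sequence for the entropy over a decreasing sequence of midpoint-convex
classes of densities converges in `L¹`, and its limit has at least the limiting entropy. -/
lemma exists_density_limit_of_antitone [IsFiniteMeasure μ] {C : ℕ → Set (α → ℝ)}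
    (hanti : Antitone C)
    (hmid : ∀ n, ∀ f ∈ C n, ∀ g ∈ C n, (fun x => (f x + g x) / 2) ∈ C n)
    (hint : ∀ n, ∀ f ∈ C n, Integrable f μ) (hnn : ∀ n, ∀ f ∈ C n, 0 ≤ᵐ[μ] f)
    (hone : ∀ n, ∀ f ∈ C n, ∫ x, f x ∂μ = 1)
    (hent : ∀ n, ∀ f ∈ C n, Integrable (fun x => f x * log (f x)) μ)
    {H : ℕ → ℝ} (hH : ∀ n, IsLUB ((fun f : α → ℝ => -∫ x, f x * log (f x) ∂μ) '' C n) (H n))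
    {L : ℝ} (hL : Tendsto H atTop (𝓝 L)) :
    ∃ F : ℕ → α → ℝ, (∀ n, F n ∈ C n) ∧ ∃ f, Integrable f μ ∧ 0 ≤ᵐ[μ] f ∧
      Tendsto (fun n => ∫ x, |F n x - f x| ∂μ) atTop (𝓝 0) ∧
      Integrable (fun x => f x * log (f x)) μ ∧ L ≤ -∫ x, f x * log (f x) ∂μ := by
  have hHanti : Antitone H := fun n m hnm => (hH m).mono (hH n) (image_mono (hanti hnm))
  have hex : ∀ n : ℕ, ∃ f ∈ C n, H n - 1 / ((n : ℝ) + 1) < -∫ x, f x * log (f x) ∂μ := by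
    intro n
    obtain ⟨_, ⟨f, hf, rfl⟩, h, -⟩ := (hH n).exists_between
      (sub_lt_self (H n) (Nat.one_div_pos_of_nat : (0 : ℝ) < 1 / ((n : ℝ) + 1)))
    exact ⟨f, hf, h⟩
  choose F hFC hF using hex
  have hFi n := hint n _ (hFC n)
  have hFe n := hent n _ (hFC n)
  have hd : Tendsto (fun n : ℕ => H n - L + 2 * (1 / ((n : ℝ) + 1))) atTop (𝓝 0) := by
    have := (hL.sub_const L).add
      ((tendsto_one_div_add_atTop_nhds_zero_nat (𝕜 := ℝ)).const_mul 2)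
    simpa using this
  have hbound : ∀ ε > 0, ∀ n m, n ≤ m →
      ∫ x, |F n x - F m x| ∂μ ≤ 6 * ε + ε⁻¹ * (H n - L + 2 * (1 / ((n : ℝ) + 1))) := by
    intro ε hε n m hnm
    have hM := hmid n _ (hFC n) _ (hanti hnm (hFC m))
    have hMi := hent n _ hM
    have hM' := (hH n).1 ⟨_, hM, rfl⟩
    have hi1 : Integrable (fun x => 3 * ε * (F n x + F m x)) μ :=
      ((hFi n).add (hFi m)).const_mul _
    have hi2 : Integrable (fun x => F n x * log (F n x) + F m x * log (F m x)) μ :=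
      (hFe n).add (hFe m)
    have hi3 : Integrable (fun x => F n x * log (F n x) + F m x * log (F m x) -
        2 * ((F n x + F m x) / 2 * log ((F n x + F m x) / 2))) μ := hi2.sub (hMi.const_mul 2)
    have h1 : ∫ x, |F n x - F m x| ∂μ ≤ ∫ x, (3 * ε * (F n x + F m x) +
        ε⁻¹ * (F n x * log (F n x) + F m x * log (F m x) -
          2 * ((F n x + F m x) / 2 * log ((F n x + F m x) / 2)))) ∂μ := by
      refine integral_mono_ae ((hFi n).sub (hFi m)).abs ?_ ?_
      · exact hi1.add (hi3.const_mul _)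
      · filter_upwards [hnn n _ (hFC n), hnn m _ (hFC m)] with x hx hy
        exact abs_sub_le_jensen_gap_mul_log hx hy hε
    rw [integral_add hi1 (hi3.const_mul _), integral_const_mul, integral_const_mul,
      integral_add (hFi n) (hFi m), integral_sub hi2 (hMi.const_mul 2),
      integral_add (hFe n) (hFe m), integral_const_mul, hone n _ (hFC n), hone m _ (hFC m)] at h1
    refine h1.trans ?_
    have hLm : L ≤ H m := hHanti.le_of_tendsto hL m
    have hm1 : 1 / ((m : ℝ) + 1) ≤ 1 / ((n : ℝ) + 1) := Nat.one_div_le_one_div hnm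
    have := hF n
    have := hF m
    have h2 : (∫ x, F n x * log (F n x) ∂μ) + (∫ x, F m x * log (F m x) ∂μ) -
        2 * ∫ x, (F n x + F m x) / 2 * log ((F n x + F m x) / 2) ∂μ ≤
        H n - L + 2 * (1 / ((n : ℝ) + 1)) := by
      simp only at hM'
      linarith
    have := mul_le_mul_of_nonneg_left h2 (inv_nonneg.2 hε.le)
    linarith
  obtain ⟨f, hfi, hft, ns, hns, hae⟩ := exists_integrable_tendsto_integral_abs_sub hFi
    (fun e he => by
      have hev := hd.eventually (gt_mem_nhds (show (0 : ℝ) < e ^ 2 / 24 by positivity))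
      obtain ⟨N, hN⟩ := eventually_atTop.1 hev
      refine ⟨N, fun n hn m hm => (hbound (e / 12) (by positivity) n m hm).trans_lt ?_⟩
      have := mul_lt_mul_of_pos_left (hN n hn) (show 0 < (e / 12)⁻¹ by positivity)
      have e1 : (e / 12)⁻¹ * (e ^ 2 / 24) = e / 2 := by
        field_simp
        norm_num
      linarith)
  have hf0 : 0 ≤ᵐ[μ] f := by
    filter_upwards [hae, ae_all_iff.2 fun n => hnn n _ (hFC n)] with x hx hx0
    exact ge_of_tendsto' hx fun i => hx0 (ns i)
  have hf1 : ∫ x, f x ∂μ = 1 := by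
    have := tendsto_integral_mul_of_tendsto_integral_abs_sub hFi hfi hft (g := fun _ => 1) (M := 1)
      aestronglyMeasurable_const (by simp)
    simp only [mul_one, hone _ _ (hFC _)] at this
    exact tendsto_nhds_unique this tendsto_const_nhds
  have hfat := integrable_and_integral_le_of_tendsto_ae (μ := μ)
    (F := fun i x => InformationTheory.klFun (F (ns i) x))
    (f := fun x => InformationTheory.klFun (f x))
    (b := fun i => -(H (ns i) - 1 / ((ns i : ℝ) + 1)) + μ.real univ - 1)
    (c := -(L - 0) + μ.real univ - 1)
    (fun i => (integrable_klFun_iff (hFi _)).2 (hFe _))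
    (fun i => by
      filter_upwards [hnn _ _ (hFC (ns i))] with x hx
      exact InformationTheory.klFun_nonneg hx)
    (InformationTheory.continuous_klFun.comp_aestronglyMeasurable hfi.1)
    (by
      filter_upwards [hae] with x hx
      exact (InformationTheory.continuous_klFun.tendsto _).comp hx)
    (fun i => by
      rw [integral_klFun_comp (hFi _) (hFe _), hone _ _ (hFC _)]
      linarith [hF (ns i)])
    (((((hL.sub tendsto_one_div_add_atTop_nhds_zero_nat).comp hns.tendsto_atTop).neg).add_const
      _).sub_const _)
  have hfe := (integrable_klFun_iff hfi).1 hfat.1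
  refine ⟨F, hFC, f, hfi, hf0, hft, hfe, ?_⟩
  have := hfat.2
  rw [integral_klFun_comp hfi hfe, hf1] at this
  linarith

/-- The probability densities of finite entropy that satisfy the moment constraints indexed
by `S`. -/
def momentDensities {ι : Type*} (μ : Measure α) (g : ι → α → ℝ) (c : ι → ℝ) (S : Set ι) :
    Set (α → ℝ) :=
  {f | Integrable f μ ∧ 0 ≤ᵐ[μ] f ∧ ∫ x, f x ∂μ = 1 ∧ Integrable (fun x => f x * log (f x)) μ ∧
    ∀ i ∈ S, ∫ x, f x * g i x ∂μ = c i}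

lemma tendsto_sSup_entropy_momentDensities {ι : Type*} [IsFiniteMeasure μ] {g : ι → α → ℝ}
    {c : ι → ℝ} (hgm : ∀ i, AEStronglyMeasurable (g i) μ)
    (hg : ∀ i, ∃ M, ∀ᵐ x ∂μ, |g i x| ≤ M) {S : ℕ → Set ι} (hS : Monotone S)
    (hne : (momentDensities μ g c (⋃ k, S k)).Nonempty) :
    Tendsto (fun k => sSup ((fun f : α → ℝ => -∫ x, f x * log (f x) ∂μ) ''
        momentDensities μ g c (S k))) atTop
      (𝓝 (sSup ((fun f : α → ℝ => -∫ x, f x * log (f x) ∂μ) ''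
        momentDensities μ g c (⋃ k, S k)))) := by
  set E : (α → ℝ) → ℝ := fun f => -∫ x, f x * log (f x) ∂μ with hE
  have hmono : ∀ {s t : Set ι}, s ⊆ t → momentDensities μ g c t ⊆ momentDensities μ g c s :=
    fun hst f hf => ⟨hf.1, hf.2.1, hf.2.2.1, hf.2.2.2.1, fun i hi => hf.2.2.2.2 i (hst hi)⟩
  have hbdd : ∀ s, BddAbove (E '' momentDensities μ g c s) := by
    rintro s
    refine ⟨μ.real univ - 1, ?_⟩
    rintro _ ⟨f, ⟨hf, hf0, hf1, hfe, -⟩, rfl⟩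
    have : 0 ≤ ∫ x, InformationTheory.klFun (f x) ∂μ := integral_nonneg_of_ae <| by
      filter_upwards [hf0] with x hx using InformationTheory.klFun_nonneg hx
    rw [integral_klFun_comp hf hfe, hf1] at this
    simp only [hE]
    linarith
  have hneS : ∀ k, (E '' momentDensities μ g c (S k)).Nonempty :=
    fun k => (hne.mono (hmono (subset_iUnion S k))).image E
  set H : ℕ → ℝ := fun k => sSup (E '' momentDensities μ g c (S k)) with hH
  have hHanti : Antitone H := fun n m hnm =>
    csSup_le_csSup (hbdd _) (hneS m) (image_mono (hmono (hS hnm)))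
  have hle : ∀ k, sSup (E '' momentDensities μ g c (⋃ k, S k)) ≤ H k := fun k =>
    csSup_le_csSup (hbdd _) (hne.image E) (image_mono (hmono (subset_iUnion S k)))
  have hL := tendsto_atTop_ciInf hHanti ⟨_, forall_mem_range.2 hle⟩
  obtain ⟨F, hF, f, hf, hf0, hlim, hfe, hfL⟩ := exists_density_limit_of_antitone
    (C := fun k => momentDensities μ g c (S k)) (fun n m hnm => hmono (hS hnm))
    (fun n f hf f' hf' => by
      obtain ⟨hi, h0, h1, he, hc⟩ := hf
      obtain ⟨hi', h0', h1', he', hc'⟩ := hf'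
      have hmi : Integrable (fun x => (f x + f' x) / 2) μ := (hi.add hi').div_const 2
      refine ⟨hmi, ?_, ?_, ?_, fun i hiS => ?_⟩
      · filter_upwards [h0, h0'] with x hx hy
        exact div_nonneg (add_nonneg hx hy) zero_le_two
      · rw [integral_div, integral_add hi hi', h1, h1']
        norm_num
      · exact (integrable_klFun_iff hmi).1 (integrable_klFun_midpoint hi hi' h0 h0'
          ((integrable_klFun_iff hi).2 he) ((integrable_klFun_iff hi').2 he'))
      · obtain ⟨M, hM⟩ := hg i
        have e : ∀ x, (f x + f' x) / 2 * g i x = (f x * g i x + f' x * g i x) / 2 := by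
          intro x
          ring
        simp only [e]
        rw [integral_div, integral_add (hi.mul_bdd (hgm i) hM) (hi'.mul_bdd (hgm i) hM),
          hc i hiS, hc' i hiS]
        ring)
    (fun n f hf => hf.1) (fun n f hf => hf.2.1) (fun n f hf => hf.2.2.1)
    (fun n f hf => hf.2.2.2.1) (fun n => isLUB_csSup (hneS n) (hbdd _)) hL
  have hlimg : ∀ {g : α → ℝ} {a M : ℝ}, AEStronglyMeasurable g μ → (∀ᵐ x ∂μ, |g x| ≤ M) →
      (∀ᶠ n in atTop, ∫ x, F n x * g x ∂μ = a) → ∫ x, f x * g x ∂μ = a := by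
    intro g a M hgm hM h
    exact tendsto_nhds_unique (tendsto_integral_mul_of_tendsto_integral_abs_sub
      (fun n => (hF n).1) hf hlim hgm hM)
      (tendsto_const_nhds.congr' (h.mono fun _ h => h.symm))
  have hfmem : f ∈ momentDensities μ g c (⋃ k, S k) := by
    refine ⟨hf, hf0, ?_, hfe, fun i hi => ?_⟩
    · simpa using hlimg (g := fun _ => 1) (M := 1) aestronglyMeasurable_const (by simp)
        (Eventually.of_forall fun n => by simpa using (hF n).2.2.1)
    · obtain ⟨k, hk⟩ := mem_iUnion.1 hi
      obtain ⟨M, hM⟩ := hg i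
      refine hlimg (hgm i) hM ?_
      filter_upwards [eventually_ge_atTop k] with n hn
      exact (hF n).2.2.2.2 i (hS hn hk)
  have heq : ⨅ k, H k = sSup (E '' momentDensities μ g c (⋃ k, S k)) :=
    le_antisymm (hfL.trans (le_csSup (hbdd _) ⟨f, hfmem, rfl⟩)) (le_ciInf hle)
  rwa [← heq]

end L1

/-- A finite measure carried by a compact interval is determined by its moments. -/
lemma Measure.eq_of_forall_integral_pow_eq {ν ν' : Measure ℝ} [IsFiniteMeasure ν]
    [IsFiniteMeasure ν'] {a b : ℝ} (hν : ∀ᵐ x ∂ν, x ∈ Icc a b) (hν' : ∀ᵐ x ∂ν', x ∈ Icc a b)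
    (h : ∀ n : ℕ, ∫ x, x ^ n ∂ν = ∫ x, x ^ n ∂ν') : ν = ν' := by
  have hbound : ∀ {κ : Measure ℝ} [IsFiniteMeasure κ], (∀ᵐ x ∂κ, x ∈ Icc a b) →
      ∀ {f : ℝ → ℝ}, Continuous f → Integrable f κ := by
    intro κ _ hκ f hf
    obtain ⟨C, hC⟩ := isCompact_Icc.exists_bound_of_continuousOn (hf.continuousOn (s := Icc a b))
    exact .of_bound hf.aestronglyMeasurable C (hκ.mono hC)
  refine ext_of_forall_integral_eq_of_IsFiniteMeasure fun f => ?_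
  have hpoly : ∀ p : Polynomial ℝ, ∫ x, p.eval x ∂ν = ∫ x, p.eval x ∂ν' := by
    intro p
    simp only [Polynomial.eval_eq_sum_range]
    rw [integral_finsetSum _ fun i _ => hbound hν (by fun_prop),
      integral_finsetSum _ fun i _ => hbound hν' (by fun_prop)]
    simp only [integral_const_mul, h]
  have happrox : ∀ {κ : Measure ℝ} [IsFiniteMeasure κ], (∀ᵐ x ∂κ, x ∈ Icc a b) →
      ∀ {p : Polynomial ℝ} {ε : ℝ}, (∀ x ∈ Icc a b, |p.eval x - f x| < ε) →
      |∫ x, p.eval x ∂κ - ∫ x, f x ∂κ| ≤ ε * κ.real univ := by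
    intro κ _ hκ p ε hp
    rw [← integral_sub (hbound hκ p.continuous) (hbound hκ f.continuous), ← Real.norm_eq_abs]
    refine norm_integral_le_of_norm_le_const (μ := κ) ?_
    filter_upwards [hκ] with x hx using (hp x hx).le
  refine eq_of_abs_sub_nonpos (le_of_forall_pos_le_add fun e he => ?_)
  have hK : 0 < ν.real univ + ν'.real univ + 1 := by positivity
  obtain ⟨p, hp⟩ := exists_polynomial_near_of_continuousOn a b f f.continuous.continuousOn
    (e / (ν.real univ + ν'.real univ + 1)) (by positivity)
  have h1 := abs_le.1 (happrox hν hp)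
  have h2 := abs_le.1 (happrox hν' hp)
  rw [hpoly p] at h1
  have h3 : e / (ν.real univ + ν'.real univ + 1) * (ν.real univ + ν'.real univ + 1) = e :=
    div_mul_cancel₀ _ hK.ne'
  have h4 : 0 < e / (ν.real univ + ν'.real univ + 1) := by positivity
  rw [zero_add, abs_le]
  constructor <;> linarith

lemma ae_dens_eq_zero_of_notMem {Ω : Type*} [MeasureSpace Ω] {Q : Measure Ω} {s : Set Ω}
    (hs : MeasurableSet s) (hQs : Q sᶜ = 0) : ∀ᵐ x, x ∉ s → dens Q x = 0 := by
  have h : ∫⁻ x in sᶜ, Q.rnDeriv volume x = 0 :=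
    le_antisymm ((Measure.setLIntegral_rnDeriv_le _).trans hQs.le) zero_le
  rw [lintegral_eq_zero_iff (Measure.measurable_rnDeriv _ _)] at h
  filter_upwards [(ae_restrict_iff' hs.compl).1 h] with x hx hxs
  simp [dens, hx hxs]

lemma integral_restrict_dens_mul {Ω : Type*} [MeasureSpace Ω] [SigmaFinite (volume : Measure Ω)]
    {Q : Measure Ω} [IsProbabilityMeasure Q] (hQ : Q ≪ volume) {s : Set Ω}
    (hs : MeasurableSet s) (hQs : Q sᶜ = 0) (g : Ω → ℝ) :
    ∫ x in s, dens Q x * g x = ∫ x, g x ∂Q := by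
  rw [setIntegral_eq_integral_of_ae_compl_eq_zero]
  · exact integral_rnDeriv_smul hQ
  · filter_upwards [ae_dens_eq_zero_of_notMem hs hQs] with x hx hxs
    simp [hx hxs]

lemma finiteEnt_iff_restrict {Ω : Type*} [MeasureSpace Ω] {Q : Measure Ω} {s : Set Ω}
    (hs : MeasurableSet s) (hQs : Q sᶜ = 0) :
    FiniteEnt Q ↔ Integrable (fun x => dens Q x * log (dens Q x)) (volume.restrict s) := by
  refine ⟨fun h => h.integrableOn, fun h => IntegrableOn.integrable_of_ae_notMem_eq_zero h ?_⟩
  filter_upwards [ae_dens_eq_zero_of_notMem hs hQs] with x hx hxs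
  simp [hx hxs]

lemma diffEnt_eq_restrict {Ω : Type*} [MeasureSpace Ω] {Q : Measure Ω} {s : Set Ω}
    (hs : MeasurableSet s) (hQs : Q sᶜ = 0) :
    diffEnt Q = -∫ x in s, dens Q x * log (dens Q x) := by
  rw [diffEnt, setIntegral_eq_integral_of_ae_compl_eq_zero]
  filter_upwards [ae_dens_eq_zero_of_notMem hs hQs] with x hx hxs
  simp [hx hxs]

lemma exists_measure_dens_ae_eq {Ω : Type*} [MeasureSpace Ω] [SigmaFinite (volume : Measure Ω)]
    {s : Set Ω} (hs : MeasurableSet s) {f : Ω → ℝ} (hf : Integrable f (volume.restrict s))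
    (hf0 : 0 ≤ᵐ[volume.restrict s] f) (hf1 : ∫ x in s, f x = 1) :
    ∃ Q : Measure Ω, IsProbabilityMeasure Q ∧ Q ≪ volume ∧ Q s = 1 ∧
      dens Q =ᵐ[volume.restrict s] f := by
  set q : Ω → ℝ≥0∞ := s.indicator fun x => ENNReal.ofReal (f x) with hq
  have hqm : AEMeasurable q volume :=
    (aemeasurable_indicator_iff hs).2 hf.1.aemeasurable.ennreal_ofReal
  have hint : ∫⁻ x in s, ENNReal.ofReal (f x) = 1 := by
    rw [← ofReal_integral_eq_lintegral_ofReal hf hf0, hf1, ENNReal.ofReal_one]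
  refine ⟨volume.withDensity q, ⟨?_⟩, withDensity_absolutelyContinuous _ _, ?_, ?_⟩
  · rw [withDensity_apply _ MeasurableSet.univ, Measure.restrict_univ, lintegral_indicator hs, hint]
  · rw [withDensity_apply _ hs, setLIntegral_indicator hs, inter_self, hint]
  · filter_upwards [ae_restrict_of_ae (Measure.rnDeriv_withDensity₀ volume hqm),
      ae_restrict_mem hs, hf0] with x hx hxs hx0
    rw [dens, hx, hq, indicator_of_mem hxs, ENNReal.toReal_ofReal hx0]

/-- The entropies of the probability measures carried by `s` that satisfy given moment constraints
are those of the corresponding densities. -/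
lemma setOf_diffEnt_eq_image_momentDensities {Ω ι : Type*} [MeasureSpace Ω]
    [SigmaFinite (volume : Measure Ω)] {s : Set Ω} (hs : MeasurableSet s)
    (g : ι → Ω → ℝ) (c : ι → ℝ) (S : Set ι) :
    {x : ℝ | ∃ Q : Measure Ω, IsProbabilityMeasure Q ∧ Q ≪ volume ∧ Q s = 1 ∧
      (∀ i ∈ S, ∫ u, g i u ∂Q = c i) ∧ FiniteEnt Q ∧ diffEnt Q = x} =
    (fun f : Ω → ℝ => -∫ x in s, f x * log (f x)) ''
      momentDensities (volume.restrict s) g c S := by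
  ext x
  constructor
  · rintro ⟨Q, hQ, hac, hQs, hc, hfe, rfl⟩
    have hQs' : Q sᶜ = 0 := (prob_compl_eq_zero_iff hs).2 hQs
    refine ⟨dens Q, ⟨Measure.integrable_toReal_rnDeriv.restrict,
      Eventually.of_forall fun _ => ENNReal.toReal_nonneg, ?_,
      (finiteEnt_iff_restrict hs hQs').1 hfe, fun i hi => ?_⟩, (diffEnt_eq_restrict hs hQs').symm⟩
    · simpa using integral_restrict_dens_mul hac hs hQs' fun _ => 1
    · rw [integral_restrict_dens_mul hac hs hQs', hc i hi]
  · rintro ⟨f, ⟨hf, hf0, hf1, hfe, hc⟩, rfl⟩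
    obtain ⟨Q, hQ, hac, hQs, hd⟩ := exists_measure_dens_ae_eq hs hf hf0 hf1
    have hQs' : Q sᶜ = 0 := (prob_compl_eq_zero_iff hs).2 hQs
    have hde : (fun x => dens Q x * log (dens Q x)) =ᵐ[volume.restrict s]
        fun x => f x * log (f x) := by
      filter_upwards [hd] with x hx
      rw [hx]
    refine ⟨Q, hQ, hac, hQs, fun i hi => ?_, (finiteEnt_iff_restrict hs hQs').2
      (hfe.congr hde.symm), ?_⟩
    · rw [← integral_restrict_dens_mul hac hs hQs', ← hc i hi]
      refine integral_congr_ae ?_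
      filter_upwards [hd] with x hx
      rw [hx]
    · rw [diffEnt_eq_restrict hs hQs', integral_congr_ae hde]

lemma isCompact_cube (d : ℕ) : IsCompact (Cube d) := isCompact_univ_pi fun _ => isCompact_Icc

lemma measurableSet_cube (d : ℕ) : MeasurableSet (Cube d) := (isCompact_cube d).measurableSet

lemma integral_pow_unif01 (n : ℕ) : ∫ x, x ^ n ∂unif01 = 1 / ((n : ℝ) + 1) := by
  rw [unif01, integral_Icc_eq_integral_Ioc, ← intervalIntegral.integral_of_le zero_le_one,
    integral_pow]
  simp

/-- A distribution on the cube is a copula distribution exactly when all positive moments of its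
marginals are those of the uniform distribution. -/
lemma isCopula_iff_forall_moment {d : ℕ} {P : Measure (Fin d → ℝ)} :
    IsCopula P ↔ IsProbabilityMeasure P ∧ P ≪ volume ∧ P (Cube d) = 1 ∧
      ∀ (i : Fin d) (n : ℕ), ∫ u, u i ^ (n + 1) ∂P = 1 / ((n : ℝ) + 2) := by
  have hmap : ∀ (i : Fin d) (n : ℕ), ∫ x, x ^ n ∂(P.map fun u => u i) = ∫ u, u i ^ n ∂P :=
    fun i n => integral_map (measurable_pi_apply i).aemeasurable (by fun_prop)
  constructor
  · rintro ⟨hP, hac, hm, hmarg⟩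
    refine ⟨hP, hac, hm, fun i n => ?_⟩
    rw [← hmap, hmarg, integral_pow_unif01]
    push_cast
    ring
  · rintro ⟨hP, hac, hm, hmom⟩
    refine ⟨hP, hac, hm, fun i => ?_⟩
    have : IsFiniteMeasure unif01 := by
      unfold unif01
      infer_instance
    refine Measure.eq_of_forall_integral_pow_eq (a := 0) (b := 1) ?_
      (ae_restrict_mem measurableSet_Icc) fun n => ?_
    · refine (ae_map_iff (measurable_pi_apply i).aemeasurable measurableSet_Icc).2 ?_
      have : ∀ᵐ u ∂P, u ∈ Cube d := mem_ae_iff_prob_eq_one (measurableSet_cube d) |>.2 hm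
      exact this.mono fun u hu => hu i trivial
    · rw [hmap, integral_pow_unif01]
      cases n with
      | zero => simp
      | succ n =>
        rw [hmom]
        push_cast
        ring

/-- Theorem `fund` (A): as the number `k` of matched uniform moments goes to infinity, the
value of the relaxed problem (A-MIND) converges to the value of the copula problem (MIND). -/
theorem a_mind_value_tendsto_mind {d R : ℕ} [NeZero R]
    (ψ : (Fin d → ℝ) → Fin R → ℝ) (hψc : Continuous ψ)
    (hψb : ∃ C, ∀ u ∈ Cube d, ∀ j, |ψ u j| ≤ C)
    (hψ1 : ∀ u, ψ u 0 = 1)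
    (hψli : ∀ θ : Fin R → ℝ,
      (∀ᵐ u ∂volume.restrict (Cube d), ∑ j, θ j * ψ u j = 0) → θ = 0)
    (β : Fin R → ℝ)
    (hfeas : ∃ P : Measure (Fin d → ℝ), IsCopula P ∧
      (∀ j, ∫ u, ψ u j ∂P = β j) ∧ FiniteEnt P) :
    Tendsto (fun k : ℕ =>
        sSup {x : ℝ | ∃ Q : Measure (Fin d → ℝ), IsProbabilityMeasure Q ∧ Q ≪ volume ∧
          Q (Cube d) = 1 ∧
          (∀ i : Fin d, ∀ j : Fin k, ∫ u, (u i) ^ ((j : ℕ) + 1) ∂Q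
            = 1 / ((j : ℕ) + 2 : ℝ)) ∧
          (∀ j, ∫ u, ψ u j ∂Q = β j) ∧ FiniteEnt Q ∧ diffEnt Q = x})
      atTop
      (nhds (sSup {x : ℝ | ∃ P : Measure (Fin d → ℝ), IsCopula P ∧
          (∀ j, ∫ u, ψ u j ∂P = β j) ∧ FiniteEnt P ∧ diffEnt P = x})) := by
  set g : (Fin d × ℕ) ⊕ Fin R → (Fin d → ℝ) → ℝ :=
    Sum.elim (fun p u => u p.1 ^ (p.2 + 1)) (fun j u => ψ u j) with hg
  set c : (Fin d × ℕ) ⊕ Fin R → ℝ := Sum.elim (fun p => 1 / ((p.2 : ℝ) + 2)) β with hc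
  set S : ℕ → Set ((Fin d × ℕ) ⊕ Fin R) :=
    fun k => {a | ∀ p, a = Sum.inl p → p.2 < k} with hS
  have hSmono : Monotone S := fun k l hkl a ha p hp => (ha p hp).trans_le hkl
  have hSunion : ⋃ k, S k = univ := by
    refine eq_univ_of_forall fun a => mem_iUnion.2 ?_
    rcases a with p | j
    · exact ⟨p.2 + 1, fun q hq => by cases hq; exact Nat.lt_succ_self _⟩
    · exact ⟨0, fun q hq => by cases hq⟩
  have hfin : IsFiniteMeasure ((volume : Measure (Fin d → ℝ)).restrict (Cube d)) :=
    isFiniteMeasure_restrict.2 (isCompact_cube d).measure_lt_top.ne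
  have hgc : ∀ a, Continuous (g a) := by
    rintro (p | j)
    · exact (continuous_apply p.1).pow _
    · exact (continuous_apply j).comp hψc
  have hval : ∀ k, {x : ℝ | ∃ Q : Measure (Fin d → ℝ), IsProbabilityMeasure Q ∧ Q ≪ volume ∧
      Q (Cube d) = 1 ∧
      (∀ i : Fin d, ∀ j : Fin k, ∫ u, (u i) ^ ((j : ℕ) + 1) ∂Q = 1 / ((j : ℕ) + 2 : ℝ)) ∧
      (∀ j, ∫ u, ψ u j ∂Q = β j) ∧ FiniteEnt Q ∧ diffEnt Q = x} =
      (fun f : (Fin d → ℝ) → ℝ => -∫ x in Cube d, f x * log (f x)) ''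
        momentDensities (volume.restrict (Cube d)) g c (S k) := by
    intro k
    rw [← setOf_diffEnt_eq_image_momentDensities (measurableSet_cube d)]
    ext x
    refine exists_congr fun Q => and_congr_right fun _ => and_congr_right fun _ =>
      and_congr_right fun _ => ?_
    rw [← and_assoc]
    refine and_congr_left fun _ => ⟨?_, fun h => ⟨fun i j => ?_, fun j => ?_⟩⟩
    · rintro ⟨h1, h2⟩ (p | j) ha
      · exact h1 p.1 ⟨p.2, ha p rfl⟩
      · exact h2 j
    · exact h (Sum.inl (i, j)) fun p hp => by cases hp; exact j.2
    · exact h (Sum.inr j) fun p hp => by cases hp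
  have hval' : {x : ℝ | ∃ P : Measure (Fin d → ℝ), IsCopula P ∧
      (∀ j, ∫ u, ψ u j ∂P = β j) ∧ FiniteEnt P ∧ diffEnt P = x} =
      (fun f : (Fin d → ℝ) → ℝ => -∫ x in Cube d, f x * log (f x)) ''
        momentDensities (volume.restrict (Cube d)) g c (⋃ k, S k) := by
    rw [← setOf_diffEnt_eq_image_momentDensities (measurableSet_cube d), hSunion]
    ext x
    refine exists_congr fun P => ?_
    rw [isCopula_iff_forall_moment]
    constructor
    · rintro ⟨⟨h1, h2, h3, h4⟩, h5, h6⟩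
      refine ⟨h1, h2, h3, ?_, h6⟩
      rintro (p | j) -
      exacts [h4 p.1 p.2, h5 j]
    · rintro ⟨h1, h2, h3, h4, h6⟩
      exact ⟨⟨h1, h2, h3, fun i n => h4 (Sum.inl (i, n)) trivial⟩,
        fun j => h4 (Sum.inr j) trivial, h6⟩
  simp only [hval, hval']
  refine tendsto_sSup_entropy_momentDensities (fun a => (hgc a).aestronglyMeasurable)
    (fun a => ?_) hSmono ?_
  · obtain ⟨M, hM⟩ := (isCompact_cube d).exists_bound_of_continuousOn (hgc a).continuousOn
    exact ⟨M, (ae_restrict_mem (measurableSet_cube d)).mono hM⟩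
  · obtain ⟨P, hP, hPβ, hPe⟩ := hfeas
    refine Nonempty.of_image (f := fun f : (Fin d → ℝ) → ℝ => -∫ x in Cube d, f x * log (f x)) ?_
    rw [← hval']
    exact ⟨_, P, hP, hPβ, hPe, rfl⟩
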